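/- The LQR cost f is differentiable at every K ∈ S, and its derivative satisfies Df(K)[E] = 2 Tr(Eᵀ M(K) Y(K)) for every m×n real matrix E; equivalently, the gradient of f with respect to the Frobenius inner product is ∇f(K) = 2 (RK − Bᵀ X(K)(A−BK)) Y(K). -/

import Mathlib

open Matrix

attribute [local instance] Matrix.normedAddCommGroup Matrix.normedSpace

/-- `M` is Schur stable: spectral radius `ρ(M) < 1`. -/
def IsSchur {k : ℕ} (M : Matrix (Fin k) (Fin k) ℝ) : Prop :=
  ∀ μ ∈ spectrum ℂ (M.map (Complex.ofReal ·)), ‖μ‖ < 1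

open Filter Topology in
/-- In a finite-dimensional complex normed algebra, an element with spectrum in the open unit
disc has powers tending to zero. -/
theorem tendsto_pow_zero_of_spectrum_lt_one {𝔸 : Type*} [NormedRing 𝔸] [NormedAlgebra ℂ 𝔸]
    [FiniteDimensional ℂ 𝔸] [Nontrivial 𝔸] {a : 𝔸} (ha : ∀ z ∈ spectrum ℂ a, ‖z‖ < 1) :
    Tendsto (fun k : ℕ => a ^ k) atTop (𝓝 0) := by
  have : CompleteSpace 𝔸 := FiniteDimensional.complete ℂ 𝔸
  have hρ : spectralRadius ℂ a < (1 : NNReal) :=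
    spectrum.spectralRadius_lt_of_forall_lt a fun z hz => ha z hz
  obtain ⟨r, hr, hr1⟩ := ENNReal.lt_iff_exists_nnreal_btwn.1 hρ
  have hr1' : r < 1 := ENNReal.coe_lt_coe.1 hr1
  have hev := (spectrum.pow_nnnorm_pow_one_div_tendsto_nhds_spectralRadius a).eventually_lt_const hr
  refine squeeze_zero_norm' ?_
    (tendsto_pow_atTop_nhds_zero_of_lt_one r.coe_nonneg (NNReal.coe_lt_one.2 hr1'))
  filter_upwards [hev, eventually_gt_atTop 0] with k hk hk0
  have h1 : ((‖a ^ k‖₊ : ENNReal) ^ (1 / k : ℝ)) ^ (k : ℝ) ≤ (r : ENNReal) ^ (k : ℝ) :=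
    ENNReal.rpow_le_rpow hk.le (Nat.cast_nonneg k)
  rw [← ENNReal.rpow_mul, one_div_mul_cancel (by positivity), ENNReal.rpow_one,
    ENNReal.rpow_natCast] at h1
  exact_mod_cast h1

theorem isOpen_setOf_spectrum_lt_one {𝔸 : Type*} [NormedRing 𝔸] [NormedAlgebra ℂ 𝔸]
    [FiniteDimensional ℂ 𝔸] : IsOpen {a : 𝔸 | ∀ z ∈ spectrum ℂ a, ‖z‖ < 1} := by
  have : CompleteSpace 𝔸 := FiniteDimensional.complete ℂ 𝔸
  have hset : {a : 𝔸 | ∀ z ∈ spectrum ℂ a, ‖z‖ < 1} =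
      spectrum ℂ ⁻¹' Set.Iic (Metric.ball (0 : ℂ) 1) := by
    ext; simp [Set.subset_def]
  rw [hset]
  exact upperHemicontinuous_iff_isOpen_preimage_Iic.1 (upperHemicontinuous_spectrum ℂ 𝔸) _
    Metric.isOpen_ball

section LinftyOp

attribute [local instance] Matrix.linftyOpNormedRing Matrix.linftyOpNormedAlgebra

open Filter Topology in
theorem tendsto_pow_zero_of_spectrum_lt_one_matrix {k : ℕ} {M : Matrix (Fin k) (Fin k) ℂ}
    (hM : ∀ z ∈ spectrum ℂ M, ‖z‖ < 1) :
    Tendsto (fun j : ℕ => M ^ j) atTop (𝓝 0) := by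
  rcases subsingleton_or_nontrivial (Matrix (Fin k) (Fin k) ℂ) with h | h
  · exact tendsto_const_nhds.congr fun j => Subsingleton.elim (0 : Matrix _ _ ℂ) (M ^ j)
  · exact tendsto_pow_zero_of_spectrum_lt_one hM

theorem isOpen_setOf_spectrum_lt_one_matrix {k : ℕ} :
    IsOpen {M : Matrix (Fin k) (Fin k) ℂ | ∀ z ∈ spectrum ℂ M, ‖z‖ < 1} :=
  isOpen_setOf_spectrum_lt_one (𝔸 := Matrix (Fin k) (Fin k) ℂ)

end LinftyOp

open Filter Topology in
theorem IsSchur.tendsto_pow {k : ℕ} {M : Matrix (Fin k) (Fin k) ℝ} (hM : IsSchur M) :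
    Tendsto (fun j : ℕ => M ^ j) atTop (𝓝 0) := by
  have h := tendsto_pow_zero_of_spectrum_lt_one_matrix hM
  have hre : Continuous fun N : Matrix (Fin k) (Fin k) ℂ => N.map Complex.re :=
    continuous_id.matrix_map Complex.continuous_re
  have h2 := (hre.tendsto 0).comp h
  have hpow (j : ℕ) : (M.map (Complex.ofReal ·)) ^ j = (M ^ j).map (Complex.ofReal ·) :=
    (map_pow (Complex.ofRealHom.mapMatrix (m := Fin k)) M j).symm
  have h0 : (0 : Matrix (Fin k) (Fin k) ℂ).map Complex.re = 0 := by ext; simp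
  rw [h0] at h2
  refine h2.congr fun j => ?_
  simp only [Function.comp_apply, hpow]
  ext; simp

theorem isOpen_setOf_isSchur {k : ℕ} : IsOpen {M : Matrix (Fin k) (Fin k) ℝ | IsSchur M} :=
  isOpen_setOf_spectrum_lt_one_matrix.preimage
    (continuous_id.matrix_map Complex.continuous_ofReal)

open Filter Topology in
/-- The homogeneous Stein equation has only the trivial solution. -/
theorem eq_zero_of_mul_mul_eq {k : ℕ} {M N Z : Matrix (Fin k) (Fin k) ℝ}
    (hM : Tendsto (fun j : ℕ => M ^ j) atTop (𝓝 0))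
    (hN : Tendsto (fun j : ℕ => N ^ j) atTop (𝓝 0)) (h : N * Z * M = Z) : Z = 0 := by
  have hj (j : ℕ) : N ^ j * Z * M ^ j = Z := by
    induction j with
    | zero => simp
    | succ j ih =>
      calc N ^ (j + 1) * Z * M ^ (j + 1) = N ^ j * (N * Z * M) * M ^ j := by
            rw [pow_succ, pow_succ' M]; simp only [Matrix.mul_assoc]
        _ = Z := by rw [h, ih]
  have ht : Tendsto (fun j : ℕ => N ^ j * Z * M ^ j) atTop (𝓝 (0 * Z * 0)) :=
    (hN.mul tendsto_const_nhds).mul hM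
  simp only [hj, mul_zero] at ht
  exact tendsto_nhds_unique tendsto_const_nhds ht

open Filter Topology in
theorem IsSchur.tendsto_transpose_pow {k : ℕ} {M : Matrix (Fin k) (Fin k) ℝ} (hM : IsSchur M) :
    Tendsto (fun j : ℕ => Mᵀ ^ j) atTop (𝓝 0) := by
  have hc : Continuous fun N : Matrix (Fin k) (Fin k) ℝ => Nᵀ := continuous_id.matrix_transpose
  simpa [Function.comp_def] using (hc.tendsto 0).comp hM.tendsto_pow

theorem IsSchur.isSymm_of_stein {k : ℕ} {L Z C : Matrix (Fin k) (Fin k) ℝ} (hL : IsSchur L)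
    (hC : C.IsSymm) (h : Lᵀ * Z * L + C = Z) : Z.IsSymm := by
  have h' : Lᵀ * Zᵀ * L + C = Zᵀ := by
    have := congrArg Matrix.transpose h
    simpa [Matrix.transpose_add, Matrix.transpose_mul, hC.eq, Matrix.mul_assoc] using this
  refine sub_eq_zero.1 (eq_zero_of_mul_mul_eq hL.tendsto_pow hL.tendsto_transpose_pow ?_)
  rw [Matrix.mul_sub, Matrix.sub_mul, eq_sub_of_add_eq h, eq_sub_of_add_eq h']
  abel

theorem IsSchur.isSymm_of_stein' {k : ℕ} {L Z C : Matrix (Fin k) (Fin k) ℝ} (hL : IsSchur L)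
    (hC : C.IsSymm) (h : L * Z * Lᵀ + C = Z) : Z.IsSymm := by
  have h' : L * Zᵀ * Lᵀ + C = Zᵀ := by
    have := congrArg Matrix.transpose h
    simpa [Matrix.transpose_add, Matrix.transpose_mul, hC.eq, Matrix.mul_assoc] using this
  refine sub_eq_zero.1 (eq_zero_of_mul_mul_eq hL.tendsto_transpose_pow hL.tendsto_pow ?_)
  rw [Matrix.mul_sub, Matrix.sub_mul, eq_sub_of_add_eq h, eq_sub_of_add_eq h']
  abel

section Calculus

variable {E : Type*} [NormedAddCommGroup E] [NormedSpace ℝ E] {l m n : ℕ}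

theorem DifferentiableAt.matrix_mul {f : E → Matrix (Fin l) (Fin m) ℝ}
    {g : E → Matrix (Fin m) (Fin n) ℝ} {x : E}
    (hf : DifferentiableAt ℝ f x) (hg : DifferentiableAt ℝ g x) :
    DifferentiableAt ℝ (fun y => f y * g y) x := by
  refine differentiableAt_pi.2 fun i => differentiableAt_pi.2 fun j => ?_
  have hf' (a : Fin m) := differentiableAt_pi.1 (differentiableAt_pi.1 hf i) a
  have hg' (a : Fin m) := differentiableAt_pi.1 (differentiableAt_pi.1 hg a) j
  simp only [Matrix.mul_apply]
  exact DifferentiableAt.fun_sum fun a _ => (hf' a).mul (hg' a)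

theorem DifferentiableAt.matrix_transpose {f : E → Matrix (Fin l) (Fin m) ℝ} {x : E}
    (hf : DifferentiableAt ℝ f x) : DifferentiableAt ℝ (fun y => (f y)ᵀ) x :=
  differentiableAt_pi.2 fun i => differentiableAt_pi.2 fun j =>
    differentiableAt_pi.1 (differentiableAt_pi.1 hf j) i

theorem DifferentiableAt.matrix_trace {f : E → Matrix (Fin n) (Fin n) ℝ} {x : E}
    (hf : DifferentiableAt ℝ f x) : DifferentiableAt ℝ (fun y => (f y).trace) x :=
  DifferentiableAt.fun_sum fun i _ => differentiableAt_pi.1 (differentiableAt_pi.1 hf i) i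

theorem HasDerivAt.matrix_mul {f : ℝ → Matrix (Fin l) (Fin m) ℝ}
    {g : ℝ → Matrix (Fin m) (Fin n) ℝ} {f' : Matrix (Fin l) (Fin m) ℝ}
    {g' : Matrix (Fin m) (Fin n) ℝ} {x : ℝ}
    (hf : HasDerivAt f f' x) (hg : HasDerivAt g g' x) :
    HasDerivAt (fun y => f y * g y) (f' * g x + f x * g') x := by
  refine hasDerivAt_pi.2 fun i => hasDerivAt_pi.2 fun j => ?_
  have hf' (a : Fin m) := hasDerivAt_pi.1 (hasDerivAt_pi.1 hf i) a
  have hg' (a : Fin m) := hasDerivAt_pi.1 (hasDerivAt_pi.1 hg a) j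
  simp only [Matrix.mul_apply, Matrix.add_apply, ← Finset.sum_add_distrib]
  exact HasDerivAt.fun_sum fun a _ => (hf' a).mul (hg' a)

theorem HasDerivAt.matrix_transpose {f : ℝ → Matrix (Fin l) (Fin m) ℝ}
    {f' : Matrix (Fin l) (Fin m) ℝ} {x : ℝ}
    (hf : HasDerivAt f f' x) : HasDerivAt (fun y => (f y)ᵀ) f'ᵀ x :=
  hasDerivAt_pi.2 fun i => hasDerivAt_pi.2 fun j => hasDerivAt_pi.1 (hasDerivAt_pi.1 hf j) i

theorem HasDerivAt.matrix_trace {f : ℝ → Matrix (Fin n) (Fin n) ℝ}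
    {f' : Matrix (Fin n) (Fin n) ℝ} {x : ℝ}
    (hf : HasDerivAt f f' x) : HasDerivAt (fun y => (f y).trace) f'.trace x :=
  HasDerivAt.fun_sum fun i _ => hasDerivAt_pi.1 (hasDerivAt_pi.1 hf i) i

end Calculus

section SteinOperator

/-- The topology of the entrywise sup norm, in the form expected by calculus on normed spaces. -/
local instance matrixNormTopology (n : ℕ) : TopologicalSpace (Matrix (Fin n) (Fin n) ℝ) :=
  (Matrix.normedAddCommGroup (m := Fin n) (n := Fin n)
    (α := ℝ)).toPseudoMetricSpace.toUniformSpace.toTopologicalSpace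

/-- Left multiplication by a matrix, as a linear map into continuous endomorphisms. -/
noncomputable def mulLeftCLM (n : ℕ) : Matrix (Fin n) (Fin n) ℝ →ₗ[ℝ]
    (Matrix (Fin n) (Fin n) ℝ →L[ℝ] Matrix (Fin n) (Fin n) ℝ) :=
  LinearMap.toContinuousLinearMap.toLinearMap ∘ₗ LinearMap.mul ℝ (Matrix (Fin n) (Fin n) ℝ)

/-- Right multiplication by a matrix, as a linear map into continuous endomorphisms. -/
noncomputable def mulRightCLM (n : ℕ) : Matrix (Fin n) (Fin n) ℝ →ₗ[ℝ]
    (Matrix (Fin n) (Fin n) ℝ →L[ℝ] Matrix (Fin n) (Fin n) ℝ) :=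
  LinearMap.toContinuousLinearMap.toLinearMap ∘ₗ (LinearMap.mul ℝ (Matrix (Fin n) (Fin n) ℝ)).flip

/-- The Stein operator `Z ↦ Z - Lᵀ Z L`. -/
noncomputable def steinCLM {n : ℕ} (L : Matrix (Fin n) (Fin n) ℝ) :
    Matrix (Fin n) (Fin n) ℝ →L[ℝ] Matrix (Fin n) (Fin n) ℝ :=
  1 - mulLeftCLM n Lᵀ * mulRightCLM n L

theorem steinCLM_apply {n : ℕ} (L Z : Matrix (Fin n) (Fin n) ℝ) :
    steinCLM L Z = Z - Lᵀ * Z * L := by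
  simp [steinCLM, mulLeftCLM, mulRightCLM, Matrix.mul_assoc]

theorem IsSchur.isUnit_steinCLM {n : ℕ} {L : Matrix (Fin n) (Fin n) ℝ} (hL : IsSchur L) :
    IsUnit (steinCLM L) := by
  have hinj : Function.Injective (steinCLM L).toLinearMap := by
    refine (injective_iff_map_eq_zero _).2 fun Z hZ => ?_
    refine eq_zero_of_mul_mul_eq hL.tendsto_pow hL.tendsto_transpose_pow ?_
    exact (sub_eq_zero.1 ((steinCLM_apply L Z).symm.trans hZ)).symm
  have hu := (LinearMap.isUnit_iff_ker_eq_bot _).2 (LinearMap.ker_eq_bot.2 hinj)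
  have := hu.map (Module.End.toContinuousLinearMap (Matrix (Fin n) (Fin n) ℝ) (𝕜 := ℝ))
  convert! this

theorem differentiableAt_steinCLM {E : Type*} [NormedAddCommGroup E] [NormedSpace ℝ E] {n : ℕ}
    {f : E → Matrix (Fin n) (Fin n) ℝ} {x : E} (hf : DifferentiableAt ℝ f x) :
    DifferentiableAt ℝ (fun y => steinCLM (f y)) x := by
  have h1 : DifferentiableAt ℝ (fun y => mulLeftCLM n (f y)ᵀ) x :=
    (mulLeftCLM n).toContinuousLinearMap.differentiableAt.comp x hf.matrix_transpose
  have h2 : DifferentiableAt ℝ (fun y => mulRightCLM n (f y)) x :=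
    (mulRightCLM n).toContinuousLinearMap.differentiableAt.comp x hf
  exact (h1.mul h2).const_sub 1

open Filter Topology in
/-- Solutions of a differentiable family of Stein equations with Schur stable coefficient depend
differentiably on the parameter. -/
theorem differentiableAt_of_stein {E : Type*} [NormedAddCommGroup E] [NormedSpace ℝ E] {n : ℕ}
    {L C X : E → Matrix (Fin n) (Fin n) ℝ} {x : E} (hL : DifferentiableAt ℝ L x)
    (hC : DifferentiableAt ℝ C x) (hx : IsSchur (L x))
    (hX : ∀ y, IsSchur (L y) → (L y)ᵀ * X y * L y + C y = X y) : DifferentiableAt ℝ X x := by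
  have hev : ∀ᶠ y in 𝓝 x, IsSchur (L y) :=
    hL.continuousAt.eventually (isOpen_setOf_isSchur.mem_nhds hx)
  have hinv : DifferentiableAt ℝ (fun y => Ring.inverse (steinCLM (L y))) x :=
    (differentiableAt_steinCLM hL).inverse hx.isUnit_steinCLM
  refine (hinv.clm_apply hC).congr_of_eventuallyEq ?_
  filter_upwards [hev] with y hy
  have h1 : steinCLM (L y) (X y) = C y := by
    rw [steinCLM_apply, sub_eq_iff_eq_add', hX y hy]
  rw [← h1, ← mul_apply_eq_comp, Ring.inverse_mul_cancel _ hy.isUnit_steinCLM]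
  rfl

end SteinOperator

theorem trace_mul_eq_trace_stein_mul {n : ℕ} {L Y S : Matrix (Fin n) (Fin n) ℝ}
    (hY : L * Y * Lᵀ + S = Y) (H : Matrix (Fin n) (Fin n) ℝ) :
    (H * S).trace = ((H - Lᵀ * H * L) * Y).trace := by
  rw [eq_sub_of_add_eq' hY, Matrix.mul_sub, Matrix.sub_mul, Matrix.trace_sub, Matrix.trace_sub]
  congr 1
  calc (H * (L * Y * Lᵀ)).trace = ((H * L * Y) * Lᵀ).trace := by simp only [Matrix.mul_assoc]
    _ = _ := by rw [Matrix.trace_mul_comm]; simp only [Matrix.mul_assoc]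

/-- Against a symmetric matrix, `W + Wᵀ` has twice the trace pairing of `W`. -/
theorem trace_add_transpose_mul {n : ℕ} {W Y : Matrix (Fin n) (Fin n) ℝ} (hY : Y.IsSymm) :
    ((W + Wᵀ) * Y).trace = 2 * (W * Y).trace := by
  have : (Wᵀ * Y).trace = (W * Y).trace := by
    rw [← Matrix.trace_transpose, Matrix.transpose_mul, Matrix.transpose_transpose, hY.eq,
      Matrix.trace_mul_comm]
  rw [Matrix.add_mul, Matrix.trace_add, this, two_mul]

theorem stmt5 {n m : ℕ} (hn : 0 < n) (hm : 0 < m)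
    (A : Matrix (Fin n) (Fin n) ℝ) (B : Matrix (Fin n) (Fin m) ℝ)
    (Q Sig : Matrix (Fin n) (Fin n) ℝ) (R : Matrix (Fin m) (Fin m) ℝ)
    (hQ : Q.PosDef) (hR : R.PosDef) (hSig : Sig.PosDef)
    (X : Matrix (Fin m) (Fin n) ℝ → Matrix (Fin n) (Fin n) ℝ)
    (Y : Matrix (Fin m) (Fin n) ℝ → Matrix (Fin n) (Fin n) ℝ)
    (hX : ∀ K, IsSchur (A - B * K) →
      (A - B * K)ᵀ * X K * (A - B * K) + Kᵀ * R * K + Q = X K)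
    (hY : ∀ K, IsSchur (A - B * K) →
      (A - B * K) * Y K * (A - B * K)ᵀ + Sig = Y K)
    (K : Matrix (Fin m) (Fin n) ℝ) (hK : IsSchur (A - B * K)) :
    DifferentiableAt ℝ (fun K' => Matrix.trace (X K' * Sig)) K ∧
    ∀ E : Matrix (Fin m) (Fin n) ℝ,
      fderiv ℝ (fun K' => Matrix.trace (X K' * Sig)) K E
        = 2 * Matrix.trace (Eᵀ * ((R * K - Bᵀ * X K * (A - B * K)) * Y K)) := by
  have hQs : Q.IsSymm := by simpa [Matrix.conjTranspose] using hQ.isHermitian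
  have hRs : R.IsSymm := by simpa [Matrix.conjTranspose] using hR.isHermitian
  have hSs : Sig.IsSymm := by simpa [Matrix.conjTranspose] using hSig.isHermitian
  have hXs : (X K).IsSymm := by
    refine hK.isSymm_of_stein (C := Kᵀ * R * K + Q) ?_ (by rw [← add_assoc]; exact hX K hK)
    refine Matrix.IsSymm.add ?_ hQs
    simp [Matrix.IsSymm, Matrix.transpose_mul, hRs.eq, Matrix.mul_assoc]
  have hYs : (Y K).IsSymm := hK.isSymm_of_stein' hSs (hY K hK)
  have hL : DifferentiableAt ℝ (fun K' : Matrix (Fin m) (Fin n) ℝ => A - B * K') K :=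
    ((differentiableAt_const B).matrix_mul differentiableAt_id).const_sub A
  have hC : DifferentiableAt ℝ (fun K' : Matrix (Fin m) (Fin n) ℝ => K'ᵀ * R * K' + Q) K :=
    ((differentiableAt_fun_id.matrix_transpose.matrix_mul
      (differentiableAt_const R)).matrix_mul differentiableAt_id).add_const Q
  have hXd : DifferentiableAt ℝ X K :=
    differentiableAt_of_stein hL hC hK fun K' h => by rw [← add_assoc]; exact hX K' h
  have hf := (hXd.matrix_mul (differentiableAt_const Sig)).matrix_trace
  refine ⟨hf, fun E => ?_⟩
  have hline : HasDerivAt (fun t : ℝ => K + t • E) E 0 := by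
    have := ((hasDerivAt_id (0 : ℝ)).smul_const E).const_add K
    rwa [one_smul] at this
  have hK0 : K + (0 : ℝ) • E = K := by simp
  set H := fderiv ℝ X K E with hH
  have hXt : HasDerivAt (fun t : ℝ => X (K + t • E)) H 0 :=
    HasFDerivAt.comp_hasDerivAt_of_eq (0 : ℝ) hXd.hasFDerivAt hline hK0.symm
  have hft : HasDerivAt (fun t : ℝ => Matrix.trace (X (K + t • E) * Sig))
      (fderiv ℝ (fun K' => Matrix.trace (X K' * Sig)) K E) 0 :=
    HasFDerivAt.comp_hasDerivAt_of_eq (0 : ℝ) hf.hasFDerivAt hline hK0.symm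
  have hft' := (hXt.matrix_mul (hasDerivAt_const (0 : ℝ) Sig)).matrix_trace
  rw [hft.unique hft', Matrix.mul_zero, add_zero, trace_mul_eq_trace_stein_mul (hY K hK)]
  have hLt : HasDerivAt (fun t : ℝ => A - B * (K + t • E)) (-(B * E)) 0 := by
    have := ((hasDerivAt_const (0 : ℝ) B).matrix_mul hline).const_sub A
    rwa [Matrix.zero_mul, zero_add] at this
  have hrhs := (((hLt.matrix_transpose.matrix_mul hXt).matrix_mul hLt).add
    ((hline.matrix_transpose.matrix_mul (hasDerivAt_const (0 : ℝ) R)).matrix_mul hline)).add_const Q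
  have hev : ∀ᶠ t : ℝ in nhds 0, IsSchur (A - B * (K + t • E)) :=
    hLt.continuousAt.eventually (isOpen_setOf_isSchur.mem_nhds (by simpa using hK))
  have hHeq := hXt.unique (hrhs.congr_of_eventuallyEq (hev.mono fun t ht => (hX _ ht).symm))
  simp only [hK0, Matrix.mul_zero, add_zero] at hHeq
  set L := A - B * K with hLdef
  have hW : H - Lᵀ * H * L = Eᵀ * (R * K - Bᵀ * X K * L) + (Eᵀ * (R * K - Bᵀ * X K * L))ᵀ := by
    rw [sub_eq_iff_eq_add']
    refine hHeq.trans ?_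
    simp only [Matrix.transpose_mul, Matrix.transpose_sub, Matrix.transpose_transpose,
      Matrix.transpose_neg, hXs.eq, hRs.eq, Matrix.mul_sub, Matrix.add_mul,
      Matrix.neg_mul, Matrix.mul_neg, Matrix.mul_assoc]
    abel
  rw [hW, trace_add_transpose_mul hYs, Matrix.mul_assoc]
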